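/- Let G be a gyrogroup and let S ⊆ G be a subset with e ∉ S. The left Cayley graph LCay(G,S) is undirected (for all u, v ∈ G, if v = s ⊕ u for some s ∈ S then u = s' ⊕ v for some s' ∈ S) if and only if S is symmetric (s ∈ S implies ⊖s ∈ S). -/

import Mathlib

/-- A gyrogroup: a set `G` with a binary operation `add` (⊕), an identity `e`,
an inverse operation `neg` (⊖), and for each pair `a b : G` a gyroautomorphism
`gyr a b : G → G`, satisfying the gyrogroup axioms. -/
class Gyrogroup (G : Type*) where
  add : G → G → G
  e : G
  neg : G → G
  gyr : G → G → G → G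
  e_add : ∀ x, add e x = x
  add_e : ∀ x, add x e = x
  neg_add : ∀ x, add (neg x) x = e
  add_neg : ∀ x, add x (neg x) = e
  gyr_bijective : ∀ a b, Function.Bijective (gyr a b)
  gyr_add : ∀ a b x y, gyr a b (add x y) = add (gyr a b x) (gyr a b y)
  left_gyroassoc : ∀ a b c, add a (add b c) = add (add a b) (gyr a b c)
  left_loop : ∀ a b, gyr (add a b) b = gyr a b

open Gyrogroup


namespace Gyrogroup

variable {G : Type*} [Gyrogroup G]

theorem add_injective (a : G) : Function.Injective (add a) := by
  intro b c h
  have h' := congrArg (add (neg a)) h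
  rw [left_gyroassoc, left_gyroassoc, neg_add, e_add, e_add] at h'
  exact (gyr_bijective _ _).injective h'

theorem gyr_e_left (a x : G) : gyr e a x = x := by
  have h := left_gyroassoc e a x
  rw [e_add, e_add] at h
  exact (add_injective a h).symm

/-- A left inverse `b` of `a` cancels `a` on the left. -/
theorem add_add_cancel_of_add_eq_e {a b : G} (h : add b a = e) (x : G) :
    add b (add a x) = x := by
  rw [left_gyroassoc, h, e_add, ← left_loop, h, gyr_e_left]

theorem eq_neg_of_add_eq_e {a b : G} (h : add b a = e) : b = neg a := by
  have h' := add_add_cancel_of_add_eq_e h (neg a)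
  rwa [add_neg, add_e] at h'

end Gyrogroup

/-- The left Cayley graph `LCay(G,S)` is undirected if and only if `S` is
symmetric. -/
theorem lcay_undirected_iff_symmetric {G : Type*} [Gyrogroup G] (S : Set G)
    (he : (e : G) ∉ S) :
    (∀ u v : G, (∃ s ∈ S, v = add s u) → ∃ s' ∈ S, u = add s' v) ↔
      (∀ s ∈ S, neg s ∈ S) := by
  constructor
  · intro h s hs
    obtain ⟨s', hs', h'⟩ := h e s ⟨s, hs, (add_e s).symm⟩
    rwa [← eq_neg_of_add_eq_e h'.symm]
  · rintro h u v ⟨s, hs, rfl⟩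
    exact ⟨neg s, h s hs, (add_add_cancel_of_add_eq_e (neg_add s) u).symm⟩
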